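/- Assume F is monotone and Lipschitz in each argument with constant L_F, A is nondecreasing and Lipschitz with constant L_A, and the CFL condition 2 L_F Δt/Δx + (2^{λ+1} c L_A/λ) Δt/Δx^λ ≤ 1 holds. Then the explicit scheme is total-variation diminishing: for every bounded sequence U : ℤ → ℝ with Σ_{i∈ℤ} |U_{i+1} − U_i| < ∞, one has Σ_{i∈ℤ} |H(U)_{i+1} − H(U)_i| ≤ Σ_{i∈ℤ} |U_{i+1} − U_i|. (Discrete one-step form of the BV bound ‖u_Δ(t,·)‖_{BV} ≤ ‖u_0‖_{BV} of Theorem 3.1(iii); it follows from the ℓ¹-contraction because H commutes with the index shift.) -/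

import Mathlib

open MeasureTheory

/-- The finite-difference weights `G_j = c ∫_{(|j|−1/2)Δx}^{(|j|+1/2)Δx} z^{−1−λ} dz`
discretizing the one-dimensional fractional Laplacian. -/
noncomputable def fracWeight (c lam Δx : ℝ) (j : ℤ) : ℝ :=
  ∫ z in ((|j| : ℝ) - 1/2) * Δx..((|j| : ℝ) + 1/2) * Δx, c * z ^ (-1 - lam)

/-- The one-step explicit finite-difference operator
`H(U)_i = U_i − (Δt/Δx)(F(U_i,U_{i+1}) − F(U_{i−1},U_i))
          + Δt ∑_{j≠0} G_j (A(U_{i+j}) − A(U_i))`. -/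
noncomputable def schemeH (c lam Δx Δt : ℝ) (F : ℝ → ℝ → ℝ) (A : ℝ → ℝ)
    (U : ℤ → ℝ) (i : ℤ) : ℝ :=
  U i - Δt / Δx * (F (U i) (U (i + 1)) - F (U (i - 1)) (U i))
    + Δt * ∑' j : {j : ℤ // j ≠ 0}, fracWeight c lam Δx j.1 * (A (U (i + j.1)) - A (U i))

lemma fracWeight_succ (lam c Δx : ℝ) (hlam₀ : 0 < lam) (hΔx : 0 < Δx) (j : ℤ) (n : ℕ)
    (hj : |(j : ℝ)| = n + 1) :
    fracWeight c lam Δx j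
      = c / lam * (((n : ℝ) + 1/2) * Δx) ^ (-lam) - c / lam * (((n + 1 : ℕ) : ℝ) + 1/2) ^ (-lam) * Δx ^ (-lam) := by
  have hn : (0:ℝ) ≤ n := Nat.cast_nonneg n
  have h1 : (0:ℝ) < ((n : ℝ) + 1/2) * Δx := by positivity
  have h2 : (0:ℝ) < ((n : ℝ) + 1 + 1/2) * Δx := by positivity
  unfold fracWeight
  rw [hj, intervalIntegral.integral_const_mul, integral_rpow]
  · have e1 : ((n : ℝ) + 1 - 1/2) = n + 1/2 := by ring
    have e2 : (-1 - lam + 1) = -lam := by ring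
    rw [e1, e2, Real.mul_rpow (x := (n : ℝ) + 1 + 1/2) (by positivity) hΔx.le]
    push_cast
    field_simp
    ring
  · right
    refine ⟨by linarith, ?_⟩
    have e1 : ((n : ℝ) + 1 - 1/2) = n + 1/2 := by ring
    rw [e1]
    intro h
    rw [Set.mem_uIcc] at h
    rcases h with h | h <;> linarith [h.1, h.2]

lemma fracWeight_nonneg (lam c Δx : ℝ) (hc : 0 < c) (hΔx : 0 < Δx) (j : ℤ) (hj : j ≠ 0) :
    0 ≤ fracWeight c lam Δx j := by
  have h1 : (1:ℝ) ≤ |(j:ℝ)| := by exact_mod_cast Int.one_le_abs hj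
  unfold fracWeight
  apply intervalIntegral.integral_nonneg
  · nlinarith
  · intro z hz
    have : 0 ≤ z := le_trans (by apply mul_nonneg <;> linarith) hz.1
    positivity

lemma hasSum_nat_weight (lam c Δx : ℝ) (hlam₀ : 0 < lam) (hc : 0 < c) (hΔx : 0 < Δx)
    (s : ℕ → ℤ) (hs : ∀ n, |((s n : ℤ) : ℝ)| = n + 1) :
    HasSum (fun n : ℕ => fracWeight c lam Δx (s n)) (c / lam * (1/2 * Δx) ^ (-lam)) := by
  have hs0 : ∀ n, s n ≠ 0 := by
    intro n h
    have := hs n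
    rw [h] at this
    have hn : (0:ℝ) ≤ n := Nat.cast_nonneg n
    simp at this
    linarith
  rw [hasSum_iff_tendsto_nat_of_nonneg (fun n => fracWeight_nonneg lam c Δx hc hΔx _ (hs0 n))]
  set g : ℕ → ℝ := fun n => c / lam * (((n : ℝ) + 1/2) * Δx) ^ (-lam) with hg
  have key : ∀ n, fracWeight c lam Δx (s n) = g n - g (n + 1) := by
    intro n
    rw [fracWeight_succ lam c Δx hlam₀ hΔx (s n) n (hs n), hg]
    simp only
    rw [Real.mul_rpow (x := ((n+1 : ℕ) : ℝ) + 1/2) (by positivity) hΔx.le]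
    ring
  simp_rw [key, Finset.sum_range_sub']
  have h0 : g 0 = c / lam * (1/2 * Δx) ^ (-lam) := by simp [hg]
  rw [h0]
  have : Filter.Tendsto g Filter.atTop (nhds (c / lam * 0)) := by
    apply Filter.Tendsto.const_mul
    refine (tendsto_rpow_neg_atTop hlam₀).comp ?_
    apply Filter.Tendsto.atTop_mul_const hΔx
    exact Filter.tendsto_atTop_add_const_right _ _ tendsto_natCast_atTop_atTop
  simpa using this.const_sub (c / lam * (1/2 * Δx) ^ (-lam))

lemma hasSum_weight (lam c Δx : ℝ) (hlam₀ : 0 < lam) (hc : 0 < c) (hΔx : 0 < Δx) :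
    HasSum (fun j : {j : ℤ // j ≠ 0} => fracWeight c lam Δx j.1)
      (2 ^ (lam + 1) * c / lam / Δx ^ lam) := by
  have hval : 2 ^ (lam + 1) * c / lam / Δx ^ lam
      = c / lam * (1/2 * Δx) ^ (-lam) + c / lam * (1/2 * Δx) ^ (-lam) := by
    rw [Real.mul_rpow (by norm_num) hΔx.le, Real.rpow_neg hΔx.le, one_div,
      Real.inv_rpow (by norm_num), Real.rpow_neg (by norm_num), inv_inv,
      Real.rpow_add (by norm_num), Real.rpow_one]
    field_simp
    ring
  rw [hval]
  have := hasSum_subtype_iff_indicator (f := fracWeight c lam Δx) (s := {j : ℤ | j ≠ 0})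
    (a := c / lam * (1/2 * Δx) ^ (-lam) + c / lam * (1/2 * Δx) ^ (-lam))
  refine this.2 ?_
  apply HasSum.of_nat_of_neg_add_one
  · rw [← hasSum_nat_add_iff' 1]
    simp only [Finset.sum_range_one]
    convert hasSum_nat_weight lam c Δx hlam₀ hc hΔx (fun n => (n + 1 : ℤ)) ?_ using 1
    · rfl
    · ext n
      rw [Set.indicator_of_mem]
      · push_cast; rfl
      · simp only [Set.mem_ofPred_eq]; omega
    · simp
    · intro n
      push_cast
      exact abs_of_nonneg (by positivity)
  · convert hasSum_nat_weight lam c Δx hlam₀ hc hΔx (fun n => -(n + 1 : ℤ)) ?_ using 1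
    · ext n
      rw [Set.indicator_of_mem]
      simp only [Set.mem_ofPred_eq]; omega
    · intro n
      push_cast
      rw [abs_neg]
      exact abs_of_nonneg (by positivity)

/-- bound for the diagonal term -/
lemma diag_bound (D p q a k r LF LA : ℝ) (hk : 0 ≤ k) (hr : 0 ≤ r)
    (hp : 0 ≤ D → 0 ≤ p) (hp' : D ≤ 0 → p ≤ 0) (hq : 0 ≤ D → 0 ≤ q) (hq' : D ≤ 0 → q ≤ 0)
    (ha : 0 ≤ D → 0 ≤ a) (ha' : D ≤ 0 → a ≤ 0)
    (hpl : |p| ≤ LF * |D|) (hql : |q| ≤ LF * |D|) (hal : |a| ≤ LA * |D|)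
    (hCFL : 2 * LF * k + r * LA ≤ 1) :
    |D - k * p - k * q - r * a| = |D| - k * |p| - k * |q| - r * |a| := by
  have h1 := mul_le_mul_of_nonneg_left hpl hk
  have h2 := mul_le_mul_of_nonneg_left hql hk
  have h3 := mul_le_mul_of_nonneg_left hal hr
  have h4 := mul_le_mul_of_nonneg_right hCFL (abs_nonneg D)
  have h5 : 0 ≤ |D| - k * |p| - k * |q| - r * |a| := by linarith
  rcases le_total 0 D with h | h
  · rw [abs_of_nonneg h, abs_of_nonneg (hp h), abs_of_nonneg (hq h), abs_of_nonneg (ha h)] at h5 ⊢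
    exact abs_of_nonneg h5
  · rw [abs_of_nonpos h, abs_of_nonpos (hp' h), abs_of_nonpos (hq' h), abs_of_nonpos (ha' h)] at h5 ⊢
    rw [abs_of_nonpos (by linarith)]
    ring

lemma conv_sum {ι : Type*} (s : ι → ℤ) (G : ι → ℝ) (hG : ∀ j, 0 ≤ G j) (S : ℝ) (hS : HasSum G S)
    (a : ℤ → ℝ) (ha0 : ∀ i, 0 ≤ a i) (ha : Summable a) :
    (∀ i, Summable fun j => G j * a (i + s j)) ∧
    HasSum (fun i => ∑' j, G j * a (i + s j)) (S * ∑' i, a i) := by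
  have h1 : Summable fun x : ι × ℤ => G x.1 * a x.2 :=
    hS.summable.mul_of_nonneg ha hG ha0
  have h1' : HasSum (fun x : ι × ℤ => G x.1 * a x.2) (S * ∑' i, a i) :=
    hS.mul ha.hasSum h1
  let e : ℤ × ι ≃ ι × ℤ :=
    { toFun := fun x => (x.2, x.1 + s x.2)
      invFun := fun y => (y.2 - s y.1, y.1)
      left_inv := fun x => by simp
      right_inv := fun y => by simp }
  have h2 : HasSum (fun x : ℤ × ι => G x.2 * a (x.1 + s x.2)) (S * ∑' i, a i) :=
    (e.hasSum_iff (f := fun x : ι × ℤ => G x.1 * a x.2)).2 h1'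
  have h3 : ∀ i, Summable fun j => G j * a (i + s j) := fun i => h2.summable.prod_factor i
  exact ⟨h3, h2.prod_fiberwise fun i => (h3 i).hasSum⟩

lemma core_bound {ι : Type*} (s : ι → ℤ) (G : ι → ℝ) (hG : ∀ j, 0 ≤ G j) (S : ℝ) (hS : HasSum G S)
    (D p q a E : ℤ → ℝ) (k t LF LA : ℝ) (hk : 0 ≤ k) (ht : 0 ≤ t)
    (hp : ∀ i, 0 ≤ D i → 0 ≤ p i) (hp' : ∀ i, D i ≤ 0 → p i ≤ 0)
    (hq : ∀ i, 0 ≤ D i → 0 ≤ q i) (hq' : ∀ i, D i ≤ 0 → q i ≤ 0)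
    (ha : ∀ i, 0 ≤ D i → 0 ≤ a i) (ha' : ∀ i, D i ≤ 0 → a i ≤ 0)
    (hpl : ∀ i, |p i| ≤ LF * |D i|) (hql : ∀ i, |q i| ≤ LF * |D i|)
    (hal : ∀ i, |a i| ≤ LA * |D i|)
    (hCFL : 2 * LF * k + (t * S) * LA ≤ 1) (hD : Summable fun i => |D i|)
    (hE : ∀ i, E i = (D i - k * p i - k * q i - (t * S) * a i) + k * p (i - 1) + k * q (i + 1)
      + t * ∑' j, G j * a (i + s j)) :
    Summable (fun i => |E i|) ∧ ∑' i, |E i| ≤ ∑' i, |D i| := by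
  have hS0 : 0 ≤ S := hS.nonneg hG
  have sp : Summable fun i => |p i| :=
    (hD.mul_left LF).of_nonneg_of_le (fun _ => abs_nonneg _) hpl
  have sq : Summable fun i => |q i| :=
    (hD.mul_left LF).of_nonneg_of_le (fun _ => abs_nonneg _) hql
  have sa : Summable fun i => |a i| :=
    (hD.mul_left LA).of_nonneg_of_le (fun _ => abs_nonneg _) hal
  obtain ⟨c1, c2⟩ := conv_sum s G hG S hS (fun i => |a i|) (fun _ => abs_nonneg _) sa
  have p2 : HasSum (fun i => |p (i - 1)|) (∑' i, |p i|) :=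
    ((Equiv.subRight (1:ℤ)).hasSum_iff (f := fun i => |p i|)).2 sp.hasSum
  have q2 : HasSum (fun i => |q (i + 1)|) (∑' i, |q i|) :=
    ((Equiv.addRight (1:ℤ)).hasSum_iff (f := fun i => |q i|)).2 sq.hasSum
  have tot := ((((((hD.hasSum.sub (sp.hasSum.mul_left k)).sub (sq.hasSum.mul_left k)).sub
    (sa.hasSum.mul_left (t * S))).add (p2.mul_left k)).add (q2.mul_left k)).add (c2.mul_left t))
  have hle : ∀ i, |E i| ≤ |D i| - k * |p i| - k * |q i| - (t * S) * |a i| + k * |p (i - 1)|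
      + k * |q (i + 1)| + t * ∑' j, G j * |a (i + s j)| := by
    intro i
    rw [hE, ← diag_bound (D i) (p i) (q i) (a i) k (t * S) LF LA hk (by positivity)
      (hp i) (hp' i) (hq i) (hq' i) (ha i) (ha' i) (hpl i) (hql i) (hal i) hCFL]
    have e : ∀ j, |G j * a (i + s j)| = G j * |a (i + s j)| := fun j => by
      rw [abs_mul, abs_of_nonneg (hG j)]
    have b1 : |∑' j, G j * a (i + s j)| ≤ ∑' j, G j * |a (i + s j)| := by
      have := norm_tsum_le_tsum_norm (f := fun j => G j * a (i + s j))
        (by simp only [Real.norm_eq_abs, e]; exact c1 i)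
      simpa only [Real.norm_eq_abs, e] using this
    refine (abs_add_le _ _).trans (add_le_add ((abs_add_le _ _).trans (add_le_add
      ((abs_add_le _ _).trans (add_le_add le_rfl ?_)) ?_)) ?_)
    · rw [abs_mul, abs_of_nonneg hk]
    · rw [abs_mul, abs_of_nonneg hk]
    · rw [abs_mul, abs_of_nonneg ht]
      exact mul_le_mul_of_nonneg_left b1 ht
  have sE : Summable fun i => |E i| :=
    tot.summable.of_nonneg_of_le (fun _ => abs_nonneg _) hle
  refine ⟨sE, (hasSum_le hle sE.hasSum tot).trans (le_of_eq ?_)⟩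
  ring

/-- the explicit scheme is total-variation diminishing under the
CFL condition: `∑_i |H(U)_{i+1} − H(U)_i| ≤ ∑_i |U_{i+1} − U_i|`. -/
theorem explicit_scheme_tvd
    (lam c Δx Δt : ℝ) (hlam₀ : 0 < lam) (hlam₂ : lam < 2) (hc : 0 < c)
    (hΔx : 0 < Δx) (hΔt : 0 < Δt)
    (F : ℝ → ℝ → ℝ) (A : ℝ → ℝ) (LF LA : ℝ)
    (hFmono₁ : ∀ v, Monotone fun u => F u v)
    (hFmono₂ : ∀ u, Antitone fun v => F u v)
    (hFlip₁ : ∀ u u' v, |F u v - F u' v| ≤ LF * |u - u'|)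
    (hFlip₂ : ∀ u v v', |F u v - F u v'| ≤ LF * |v - v'|)
    (hAmono : Monotone A)
    (hAlip : ∀ a b, |A a - A b| ≤ LA * |a - b|)
    (hCFL : 2 * LF * Δt / Δx + 2 ^ (lam + 1) * c * LA / lam * (Δt / Δx ^ lam) ≤ 1)
    (U : ℤ → ℝ) (hU : ∃ K : ℝ, ∀ i, |U i| ≤ K)
    (hTV : Summable (fun i => |U (i + 1) - U i|)) :
    Summable (fun i => |schemeH c lam Δx Δt F A U (i + 1) - schemeH c lam Δx Δt F A U i|) ∧
    (∑' i, |schemeH c lam Δx Δt F A U (i + 1) - schemeH c lam Δx Δt F A U i|)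
      ≤ ∑' i, |U (i + 1) - U i| := by
  obtain ⟨K, hK⟩ := hU
  have hS := hasSum_weight lam c Δx hlam₀ hc hΔx
  set S : ℝ := 2 ^ (lam + 1) * c / lam / Δx ^ lam with hSdef
  have hG : ∀ j : {j : ℤ // j ≠ 0}, 0 ≤ fracWeight c lam Δx j.1 := fun j =>
    fracWeight_nonneg lam c Δx hc hΔx j.1 j.2
  -- summability of the nonlocal sums
  have hsum1 : ∀ i : ℤ, Summable fun j : {j : ℤ // j ≠ 0} =>
      fracWeight c lam Δx j.1 * A (U (i + j.1)) := by
    intro i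
    refine Summable.of_norm_bounded (hS.summable.mul_right (|A K| + |A (-K)|)) ?_
    intro j
    rw [Real.norm_eq_abs, abs_mul, abs_of_nonneg (hG j)]
    refine mul_le_mul_of_nonneg_left ?_ (hG j)
    have h := abs_le.1 (hK (i + j.1))
    have h1 := hAmono h.1
    have h2 := hAmono h.2
    rw [abs_le]
    constructor
    · linarith [neg_abs_le (A (-K)), abs_nonneg (A K)]
    · linarith [le_abs_self (A K), abs_nonneg (A (-K))]
  have hT : ∀ i : ℤ, ∑' j : {j : ℤ // j ≠ 0},
      fracWeight c lam Δx j.1 * (A (U (i + j.1)) - A (U i))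
      = (∑' j : {j : ℤ // j ≠ 0}, fracWeight c lam Δx j.1 * A (U (i + j.1))) - S * A (U i) := by
    intro i
    simp_rw [mul_sub]
    rw [(hsum1 i).tsum_sub (hS.summable.mul_right _), tsum_mul_right, hS.tsum_eq]
  refine core_bound (fun j : {j : ℤ // j ≠ 0} => j.1) (fun j => fracWeight c lam Δx j.1) hG S hS
    (fun i => U (i + 1) - U i)
    (fun i => F (U (i + 1)) (U (i + 1 + 1)) - F (U i) (U (i + 1 + 1)))
    (fun i => F (U (i - 1)) (U i) - F (U (i - 1)) (U (i + 1)))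
    (fun i => A (U (i + 1)) - A (U i)) _ (Δt / Δx) Δt LF LA (by positivity) hΔt.le
    ?_ ?_ ?_ ?_ ?_ ?_ ?_ ?_ ?_ ?_ hTV ?_
  · exact fun i h => sub_nonneg.2 (hFmono₁ _ (sub_nonneg.1 h))
  · exact fun i h => sub_nonpos.2 (hFmono₁ _ (sub_nonpos.1 h))
  · exact fun i h => sub_nonneg.2 (hFmono₂ _ (sub_nonneg.1 h))
  · exact fun i h => sub_nonpos.2 (hFmono₂ _ (sub_nonpos.1 h))
  · exact fun i h => sub_nonneg.2 (hAmono (sub_nonneg.1 h))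
  · exact fun i h => sub_nonpos.2 (hAmono (sub_nonpos.1 h))
  · exact fun i => hFlip₁ _ _ _
  · intro i
    rw [abs_sub_comm (U (i + 1))]
    exact hFlip₂ _ _ _
  · exact fun i => hAlip _ _
  · refine le_trans (le_of_eq ?_) hCFL
    rw [hSdef]
    ring
  · intro i
    have hT2 : ∑' j : {j : ℤ // j ≠ 0},
        fracWeight c lam Δx j.1 * (A (U (i + j.1 + 1)) - A (U (i + j.1)))
        = (∑' j : {j : ℤ // j ≠ 0}, fracWeight c lam Δx j.1 * A (U (i + 1 + j.1)))
          - ∑' j : {j : ℤ // j ≠ 0}, fracWeight c lam Δx j.1 * A (U (i + j.1)) := by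
      rw [← (hsum1 (i + 1)).tsum_sub (hsum1 i)]
      refine tsum_congr fun j => ?_
      rw [add_right_comm i j.1 1]
      ring
    simp only [schemeH]
    rw [hT, hT, hT2]
    simp only [sub_add_cancel, add_sub_cancel_right]
    ring
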